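/- Let H be a separable real Hilbert space, ε > 0, δ ≥ 0, β > 0. Let D and D̂ be bounded positive operators on H with D̂ − D Hilbert–Schmidt and ‖D̂ − D‖₂ ≤ δ. Let Φ be a Hilbert–Schmidt operator on H, set R₀ := D^β Φ D^β and C₀ := D^{1/2} R₀ D^{1/2}, and let Ĉ₀ be a Hilbert–Schmidt operator with ‖Ĉ₀ − C₀‖₂ ≤ δ. Define R̂₀ := (εI + D̂)^{−1/2} Ĉ₀ (εI + D̂)^{−1/2}. Then, with b := min(β, 1), ‖R̂₀ − R₀‖₂ ≤ 2(1 + ‖R₀‖₂)( δ²/ε² + δ/ε ) + 2 ε^{b} ‖Φ‖₂ ‖D‖^{2β − b}. -/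

import Mathlib

set_option linter.unusedSectionVars false

section Helpers

variable {E : Type*} [NormedAddCommGroup E] [InnerProductSpace ℝ E] [CompleteSpace E]

/-- `A` is Hilbert-Schmidt with norm at most `c`. -/
def HSle {ι : Type*} (e : HilbertBasis ι ℝ E) (A : E →L[ℝ] E) (c : ℝ) : Prop :=
  (Summable fun i => ‖A (e i)‖ ^ 2) ∧ Real.sqrt (∑' i, ‖A (e i)‖ ^ 2) ≤ c

lemma HSle.nonneg {ι : Type*} {e : HilbertBasis ι ℝ E} {A : E →L[ℝ] E} {c : ℝ}
    (h : HSle e A c) : 0 ≤ c := (Real.sqrt_nonneg _).trans h.2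

lemma HSle.add {ι : Type*} {e : HilbertBasis ι ℝ E} {A B : E →L[ℝ] E} {a b : ℝ}
    (hA : HSle e A a) (hB : HSle e B b) : HSle e (A + B) (a + b) := by
  have h := Real.Lp_add_le_tsum_of_nonneg (p := 2) (f := fun i => ‖A (e i)‖)
    (g := fun i => ‖B (e i)‖) (by norm_num) (fun i => norm_nonneg _) (fun i => norm_nonneg _)
    (by simpa using hA.1) (by simpa using hB.1)
  simp only [Real.rpow_two, ← Real.sqrt_eq_rpow] at h
  have hle : ∀ i, ‖(A + B) (e i)‖ ^ 2 ≤ (‖A (e i)‖ + ‖B (e i)‖) ^ 2 := fun i =>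
    pow_le_pow_left₀ (norm_nonneg _) (by simpa using norm_add_le (A (e i)) (B (e i))) 2
  have hs : Summable fun i => ‖(A + B) (e i)‖ ^ 2 :=
    Summable.of_nonneg_of_le (fun i => by positivity) hle h.1
  refine ⟨hs, ?_⟩
  calc _ ≤ Real.sqrt (∑' i, (‖A (e i)‖ + ‖B (e i)‖) ^ 2) :=
        Real.sqrt_le_sqrt (hs.tsum_le_tsum hle h.1)
    _ ≤ _ := h.2.trans (add_le_add hA.2 hB.2)

lemma HSle.mul_left {ι : Type*} {e : HilbertBasis ι ℝ E} {A B : E →L[ℝ] E} {a k : ℝ}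
    (hA : HSle e A a) (hB : ‖B‖ ≤ k) : HSle e (B * A) (k * a) := by
  have hk : 0 ≤ k := (norm_nonneg _).trans hB
  have hle : ∀ i, ‖(B * A) (e i)‖ ^ 2 ≤ k ^ 2 * ‖A (e i)‖ ^ 2 := fun i => by
    rw [← mul_pow]
    exact pow_le_pow_left₀ (norm_nonneg _) (B.le_of_opNorm_le hB _) 2
  have hs2 := hA.1.mul_left (k ^ 2)
  have hs : Summable fun i => ‖(B * A) (e i)‖ ^ 2 :=
    Summable.of_nonneg_of_le (fun i => by positivity) hle hs2
  refine ⟨hs, ?_⟩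
  calc _ ≤ Real.sqrt (∑' i, k ^ 2 * ‖A (e i)‖ ^ 2) :=
        Real.sqrt_le_sqrt (hs.tsum_le_tsum hle hs2)
    _ = k * Real.sqrt (∑' i, ‖A (e i)‖ ^ 2) := by
        rw [tsum_mul_left, Real.sqrt_mul (by positivity), Real.sqrt_sq hk]
    _ ≤ _ := mul_le_mul_of_nonneg_left hA.2 hk

lemma parseval {ι : Type*} (e : HilbertBasis ι ℝ E) (x : E) :
    HasSum (fun j => (inner ℝ x (e j)) ^ 2) (‖x‖ ^ 2) := by
  have h := e.hasSum_inner_mul_inner x x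
  rw [real_inner_self_eq_norm_sq] at h
  have e1 : (fun j => (inner ℝ x (e j)) ^ 2) = fun j => inner ℝ x (e j) * inner ℝ (e j) x := by
    funext j
    rw [real_inner_comm x (e j), sq]
  rw [e1]
  exact h

lemma HSle_iff {ι : Type*} {e : HilbertBasis ι ℝ E} {A : E →L[ℝ] E} {c : ℝ} (hc : 0 ≤ c) :
    HSle e A c ↔ ∑' i, ENNReal.ofReal (‖A (e i)‖ ^ 2) ≤ ENNReal.ofReal (c ^ 2) := by
  constructor
  · intro h
    rw [← ENNReal.ofReal_tsum_of_nonneg (fun i => by positivity) h.1]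
    exact ENNReal.ofReal_le_ofReal ((Real.sqrt_le_left hc).1 h.2)
  · intro h
    have hs : Summable fun i => ‖A (e i)‖ ^ 2 := by
      have h1 := ENNReal.summable_toReal (ne_top_of_le_ne_top ENNReal.ofReal_ne_top h)
      convert h1 using 2 with i
      rw [ENNReal.toReal_ofReal (by positivity)]
    rw [← ENNReal.ofReal_tsum_of_nonneg (fun i => by positivity) hs,
      ENNReal.ofReal_le_ofReal_iff (by positivity)] at h
    exact ⟨hs, Real.sqrt_le_iff.2 ⟨hc, h⟩⟩

lemma HSle.adjoint {ι : Type*} {e : HilbertBasis ι ℝ E} {A : E →L[ℝ] E} {a : ℝ}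
    (hA : HSle e A a) : HSle e (ContinuousLinearMap.adjoint A) a := by
  have ha := hA.nonneg
  rw [HSle_iff ha] at hA ⊢
  refine le_of_eq_of_le ?_ hA
  have key : ∀ B : E →L[ℝ] E, ∀ i, ENNReal.ofReal (‖B (e i)‖ ^ 2) =
      ∑' j, ENNReal.ofReal ((inner ℝ (B (e i)) (e j)) ^ 2) := fun B i => by
    rw [← (parseval e (B (e i))).tsum_eq, ENNReal.ofReal_tsum_of_nonneg
      (fun i => by positivity) (parseval e (B (e i))).summable]
  simp_rw [key]
  rw [ENNReal.tsum_comm]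
  refine tsum_congr fun i => tsum_congr fun j => ?_
  rw [ContinuousLinearMap.adjoint_inner_left, real_inner_comm]

lemma HSle.mul_right {ι : Type*} {e : HilbertBasis ι ℝ E} {A B : E →L[ℝ] E} {a k : ℝ}
    (hA : HSle e A a) (hB : ‖B‖ ≤ k) : HSle e (A * B) (a * k) := by
  have h := (hA.adjoint.mul_left (B := ContinuousLinearMap.adjoint B) (k := k)
    (by simpa using hB)).adjoint
  rw [mul_comm a k]
  convert h using 1
  rw [ContinuousLinearMap.mul_def, ContinuousLinearMap.mul_def,
    ContinuousLinearMap.adjoint_comp]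
  simp

lemma HSle.norm_le {ι : Type*} {e : HilbertBasis ι ℝ E} {A : E →L[ℝ] E} {a : ℝ}
    (hA : HSle e A a) : ‖A‖ ≤ a := by
  have ha := hA.nonneg
  have h := hA.adjoint
  refine A.opNorm_le_bound ha fun x => ?_
  refine le_of_sq_le_sq ?_ (by positivity)
  have h1 := parseval e (A x)
  have h2 := h.1.mul_right (‖x‖ ^ 2)
  rw [← h1.tsum_eq, mul_pow]
  calc _ ≤ ∑' i, ‖(ContinuousLinearMap.adjoint A) (e i)‖ ^ 2 * ‖x‖ ^ 2 := by
        refine h1.summable.tsum_le_tsum (fun i => ?_) h2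
        rw [← ContinuousLinearMap.adjoint_inner_right, ← mul_pow, mul_comm]
        exact sq_le_sq' (neg_le_of_abs_le (abs_real_inner_le_norm _ _))
          (real_inner_le_norm _ _)
    _ = (∑' i, ‖(ContinuousLinearMap.adjoint A) (e i)‖ ^ 2) * ‖x‖ ^ 2 := tsum_mul_right
    _ ≤ _ := by
        gcongr
        exact (Real.sqrt_le_left ha).1 h.2

/-- symmetric operator -/
def SymOp (T : E →L[ℝ] E) : Prop := ∀ x y, inner ℝ (T x) y = inner ℝ x (T y)

lemma nonneg_iff' (T : E →L[ℝ] E) : 0 ≤ T ↔ SymOp T ∧ ∀ x, 0 ≤ inner ℝ (T x) x := by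
  rw [ContinuousLinearMap.nonneg_iff_isPositive]
  exact Iff.rfl

lemma sym_norm_le {X : E →L[ℝ] E} (hX : SymOp X) {m : ℝ} (hm : 0 ≤ m)
    (h : ∀ x, |inner ℝ (X x) x| ≤ m * ‖x‖ ^ 2) : ‖X‖ ≤ m := by
  refine X.opNorm_le_bound hm fun x => ?_
  have key : ∀ t : ℝ, 4 * t * ‖X x‖ ^ 2 ≤ m * (2 * ‖x‖ ^ 2 + 2 * t ^ 2 * ‖X x‖ ^ 2) := by
    intro t
    have h1 := (abs_le.1 (h (x + t • X x))).2
    have h2 := (abs_le.1 (h (x - t • X x))).1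
    have h3 := parallelogram_law_with_norm ℝ x (t • X x)
    have h4 : ‖t • X x‖ ^ 2 = t ^ 2 * ‖X x‖ ^ 2 := by
      rw [norm_smul, mul_pow, Real.norm_eq_abs, sq_abs]
    have h5 : inner ℝ (X (x + t • X x)) (x + t • X x) - inner ℝ (X (x - t • X x)) (x - t • X x)
        = 4 * t * ‖X x‖ ^ 2 := by
      simp only [map_add, map_sub, map_smul, inner_add_left, inner_add_right, inner_sub_left,
        inner_sub_right, inner_smul_left, inner_smul_right, hX (X x) x,
        real_inner_self_eq_norm_sq]
      simp
      ring
    have h6 : ‖x + t • X x‖ ^ 2 + ‖x - t • X x‖ ^ 2 = 2 * ‖x‖ ^ 2 + 2 * t ^ 2 * ‖X x‖ ^ 2 := by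
      nlinarith
    rw [← h6, ← h5]
    linarith
  rcases eq_or_lt_of_le (norm_nonneg (X x)) with h0 | h0
  · rw [← h0]; positivity
  have h1 := key (‖x‖ / ‖X x‖)
  field_simp at h1
  rcases eq_or_lt_of_le (norm_nonneg x) with hx | hx
  · have : x = 0 := norm_eq_zero.1 hx.symm
    simp [this]
  nlinarith

lemma exists_sqrt_aux {ε : ℝ} (hε : 0 < ε) {D : E →L[ℝ] E} (hD : 0 ≤ D) :
    ∃ Q : E →L[ℝ] E, 0 ≤ Q ∧ Q * Q = ε • (1 : E →L[ℝ] E) + D ∧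
      ∀ B, Commute B D → Commute B Q := by
  obtain ⟨hDs, hDp⟩ := (nonneg_iff' D).1 hD
  set M := ε + ‖D‖ with hM
  have hMpos : 0 < M := by positivity
  set K : E →L[ℝ] E := M⁻¹ • (‖D‖ • (1 : E →L[ℝ] E) - D) with hK
  set k := ‖D‖ / M with hk
  have hk0 : 0 ≤ k := by positivity
  have hk1 : k < 1 := by rw [hk, div_lt_one hMpos]; linarith
  have hKs : SymOp K := fun x y => by
    simp [hK, inner_smul_left, inner_smul_right, inner_sub_left, inner_sub_right, hDs x y]
  have hKn : ‖K‖ ≤ k := by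
    refine sym_norm_le hKs hk0 fun x => ?_
    have h1 : inner ℝ (K x) x = M⁻¹ * (‖D‖ * ‖x‖ ^ 2 - inner ℝ (D x) x) := by
      simp [hK, inner_smul_left, inner_sub_left]
    have h2 : inner ℝ (D x) x ≤ ‖D‖ * ‖x‖ ^ 2 := by
      calc _ ≤ ‖D x‖ * ‖x‖ := real_inner_le_norm _ _
        _ ≤ ‖D‖ * ‖x‖ * ‖x‖ := by gcongr; exact D.le_opNorm x
        _ = _ := by ring
    rw [h1, abs_of_nonneg (by have := sub_nonneg.2 h2; positivity), hk, div_eq_inv_mul, mul_assoc]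
    gcongr
    linarith [hDp x]
  set r := 1 - Real.sqrt (1 - k) with hr
  have hsq : Real.sqrt (1 - k) ^ 2 = 1 - k := Real.sq_sqrt (by linarith)
  have hspos : 0 < Real.sqrt (1 - k) := Real.sqrt_pos.2 (by linarith)
  have hr0 : 0 ≤ r := by
    have : Real.sqrt (1 - k) ≤ 1 := Real.sqrt_le_one.2 (by linarith)
    linarith
  have hr1 : r < 1 := by linarith
  have hrk : k + r ^ 2 = 2 * r := by rw [hr]; nlinarith
  let s : Set (E →L[ℝ] E) := {Y | ‖Y‖ ≤ r ∧ (∀ x y, inner ℝ (Y x) y = inner ℝ x (Y y)) ∧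
    ∀ B, Commute B D → B * Y = Y * B}
  let f : (E →L[ℝ] E) → (E →L[ℝ] E) := fun Y => (1 / 2 : ℝ) • (K + Y * Y)
  have hsc : IsComplete s := by
    apply IsClosed.isComplete
    have e1 : s = {Y | ‖Y‖ ≤ r} ∩ ((⋂ x, ⋂ y, {Y | inner ℝ (Y x) y = inner ℝ x (Y y)}) ∩
        ⋂ B, ⋂ (_ : Commute B D), {Y : E →L[ℝ] E | B * Y = Y * B}) := by
      ext Y; simp [s]
    rw [e1]
    refine (isClosed_le (by fun_prop) (by fun_prop)).inter (IsClosed.inter ?_ ?_)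
    · exact isClosed_iInter fun x => isClosed_iInter fun y =>
        isClosed_eq (by fun_prop) (by fun_prop)
    · exact isClosed_iInter fun B => isClosed_iInter fun _ =>
        isClosed_eq (by fun_prop) (by fun_prop)
  have hsf : Set.MapsTo f s s := by
    rintro Y ⟨hY1, hY2, hY3⟩
    refine ⟨?_, ?_, ?_⟩
    · calc ‖f Y‖ = (1 / 2) * ‖K + Y * Y‖ := by
              change ‖(1 / 2 : ℝ) • (K + Y * Y)‖ = _
              rw [norm_smul]; norm_num
        _ ≤ (1 / 2) * (k + r * r) := by
          gcongr
          refine (norm_add_le _ _).trans (add_le_add hKn ((norm_mul_le _ _).trans ?_))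
          gcongr
        _ = r := by linarith
    · intro x y
      simp [f, inner_smul_left, inner_smul_right, inner_add_left, inner_add_right, hKs x y, hY2]
    · intro B hB
      have h1 := hY3 B hB
      have h2 : B * D = D * B := hB
      simp only [f, hK, mul_smul_comm, smul_mul_assoc, mul_add, add_mul, mul_sub, sub_mul, h2,
        mul_one, one_mul]
      rw [← mul_assoc, h1, mul_assoc, h1, mul_assoc]
  have hcon : ContractingWith ⟨r, hr0⟩ (hsf.restrict f s s) := by
    refine ⟨by exact_mod_cast hr1, LipschitzWith.of_dist_le_mul ?_⟩
    rintro ⟨Y, hY⟩ ⟨Z, hZ⟩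
    change dist (f Y) (f Z) ≤ r * dist Y Z
    rw [dist_eq_norm, dist_eq_norm]
    have : f Y - f Z = (1 / 2 : ℝ) • (Y * (Y - Z) + (Y - Z) * Z) := by
      simp only [f, ← smul_sub]; congr 1; noncomm_ring
    rw [this, norm_smul]
    have h1 : ‖Y * (Y - Z)‖ ≤ r * ‖Y - Z‖ := (norm_mul_le _ _).trans (by gcongr; exact hY.1)
    have h2 : ‖(Y - Z) * Z‖ ≤ ‖Y - Z‖ * r := (norm_mul_le _ _).trans (by gcongr; exact hZ.1)
    have h3 := norm_add_le (Y * (Y - Z)) ((Y - Z) * Z)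
    norm_num
    linarith
  obtain ⟨Y, hYs, hYf, -⟩ := ContractingWith.exists_fixedPoint' hsc hsf hcon (x := 0)
    ⟨by simpa using hr0, by simp, by simp⟩ (edist_ne_top _ _)
  obtain ⟨hY1, hY2, hY3⟩ := hYs
  have hYf' : (1 / 2 : ℝ) • (K + Y * Y) = Y := hYf
  have hYY : Y * Y = (2 : ℝ) • Y - K := by
    nth_rewrite 3 [← hYf']
    rw [smul_smul]; norm_num
  refine ⟨Real.sqrt M • (1 - Y), ?_, ?_, ?_⟩
  · rw [nonneg_iff']
    refine ⟨fun x y => ?_, fun x => ?_⟩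
    · simp [inner_smul_left, inner_smul_right, inner_sub_left, inner_sub_right, hY2]
    · have h1 : inner ℝ (Y x) x ≤ ‖x‖ ^ 2 := by
        calc _ ≤ ‖Y x‖ * ‖x‖ := real_inner_le_norm _ _
          _ ≤ 1 * ‖x‖ * ‖x‖ := by gcongr; exact Y.le_of_opNorm_le (hY1.trans hr1.le) x
          _ = _ := by ring
      simp only [smul_apply, sub_apply,
        one_apply_eq_self, inner_smul_left, inner_sub_left,
        real_inner_self_eq_norm_sq]
      exact mul_nonneg (Real.sqrt_nonneg _) (sub_nonneg.2 h1)
  · have h1 : (1 - Y) * (1 - Y) = 1 - (2 : ℝ) • Y + Y * Y := by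
      rw [two_smul]; noncomm_ring
    rw [smul_mul_smul_comm, Real.mul_self_sqrt hMpos.le, h1, hYY]
    have h2 : (1 : E →L[ℝ] E) - (2 : ℝ) • Y + ((2 : ℝ) • Y - K) = 1 - K := by abel
    rw [h2, smul_sub, hK, smul_smul, mul_inv_cancel₀ hMpos.ne', one_smul, hM, add_smul]
    abel
  · intro B hB
    have := hY3 B hB
    change _ * _ = _ * _
    simp only [mul_smul_comm, smul_mul_assoc, mul_sub, sub_mul, this, mul_one, one_mul]

lemma norm_sq_root {ε : ℝ} {D Q : E →L[ℝ] E} (hQs : SymOp Q)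
    (hQ : Q * Q = ε • (1 : E →L[ℝ] E) + D) (x : E) :
    ‖Q x‖ ^ 2 = ε * ‖x‖ ^ 2 + inner ℝ (D x) x := by
  have h1 : Q (Q x) = ε • x + D x := by
    have := congrArg (fun T : E →L[ℝ] E => T x) hQ
    simpa using this
  rw [← real_inner_self_eq_norm_sq, ← hQs (Q x) x, h1, inner_add_left, inner_smul_left,
    real_inner_self_eq_norm_sq]
  simp

lemma root_facts {ε : ℝ} (hε : 0 < ε) {D Q : E →L[ℝ] E} (hD : 0 ≤ D) (hQ0 : 0 ≤ Q)
    (hQ : Q * Q = ε • (1 : E →L[ℝ] E) + D) :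
    Q * Ring.inverse Q = 1 ∧ Ring.inverse Q * Q = 1 ∧ SymOp (Ring.inverse Q) ∧
      ‖Ring.inverse Q‖ ≤ (Real.sqrt ε)⁻¹ ∧
      ∀ x, Real.sqrt ε * ‖x‖ ^ 2 ≤ inner ℝ (Q x) x := by
  obtain ⟨hDs, hDp⟩ := (nonneg_iff' D).1 hD
  obtain ⟨hQs, hQp⟩ := (nonneg_iff' Q).1 hQ0
  have hu2 : IsUnit (Q * Q) := by
    refine ContinuousLinearMap.isUnit_of_forall_le_norm_inner_map (Q * Q) (c := ⟨ε, hε.le⟩)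
      (by exact_mod_cast hε) fun x => ?_
    have h1 : inner ℝ ((Q * Q) x) x = ‖Q x‖ ^ 2 := by
      rw [← real_inner_self_eq_norm_sq, ← hQs (Q x) x]; rfl
    rw [h1, norm_sq_root hQs hQ x]
    change ‖x‖ ^ 2 * ε ≤ _
    rw [Real.norm_eq_abs]
    refine le_trans ?_ (le_abs_self _)
    linarith [hDp x]
  have hu : IsUnit Q := ((Commute.refl Q).isUnit_mul_iff.1 hu2).1
  have h1 := Ring.mul_inverse_cancel Q hu
  have h2 := Ring.inverse_mul_cancel Q hu
  set G := Ring.inverse Q with hG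
  have hQG : ∀ x, Q (G x) = x := fun x => by
    simpa using congrArg (fun T : E →L[ℝ] E => T x) h1
  have hs : SymOp G := fun x y => by
    conv_lhs => rw [← hQG y]
    rw [← hQs, hQG]
  have hs0 : 0 < Real.sqrt ε := Real.sqrt_pos.2 hε
  have hn : ‖G‖ ≤ (Real.sqrt ε)⁻¹ := by
    refine G.opNorm_le_bound (by positivity) fun x => ?_
    have h3 := norm_sq_root hQs hQ (G x)
    rw [hQG] at h3
    rw [inv_mul_eq_div, le_div_iff₀ hs0]
    refine le_of_sq_le_sq ?_ (norm_nonneg _)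
    rw [mul_pow, Real.sq_sqrt hε.le, h3]
    linarith [hDp (G x)]
  refine ⟨h1, h2, hs, hn, fun x => ?_⟩
  have h3 := hQp (x - Real.sqrt ε • G x)
  have h4 : inner ℝ (Q (x - Real.sqrt ε • G x)) (x - Real.sqrt ε • G x) =
      inner ℝ (Q x) x - 2 * Real.sqrt ε * ‖x‖ ^ 2 + ε * inner ℝ x (G x) := by
    have h5 : inner ℝ (Q x) (G x) = ‖x‖ ^ 2 := by
      rw [hQs, hQG, real_inner_self_eq_norm_sq]
    simp only [map_sub, map_smul, hQG, inner_sub_left, inner_sub_right, inner_smul_left,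
      inner_smul_right, h5, real_inner_self_eq_norm_sq]
    have h6 : ε = Real.sqrt ε * Real.sqrt ε := (Real.mul_self_sqrt hε.le).symm
    simp only [conj_trivial]
    linear_combination (-(inner ℝ x (G x))) * h6
  have h5 : inner ℝ x (G x) ≤ (Real.sqrt ε)⁻¹ * ‖x‖ ^ 2 := by
    calc _ ≤ ‖x‖ * ‖G x‖ := real_inner_le_norm _ _
      _ ≤ ‖x‖ * ((Real.sqrt ε)⁻¹ * ‖x‖) := by gcongr; exact G.le_of_opNorm_le hn x
      _ = _ := by ring
  have h6 : ε * inner ℝ x (G x) ≤ Real.sqrt ε * ‖x‖ ^ 2 := by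
    calc _ ≤ ε * ((Real.sqrt ε)⁻¹ * ‖x‖ ^ 2) := by gcongr
      _ = Real.sqrt ε * ‖x‖ ^ 2 := by
        nth_rewrite 1 [← Real.mul_self_sqrt hε.le]
        field_simp
  linarith

lemma sylvester {s d : ℝ} (hs : 0 < s) {Q Q' Y : E →L[ℝ] E}
    (hQ : 0 ≤ Q) (hQ' : 0 ≤ Q') (hb : ∀ x, s * ‖x‖ ^ 2 ≤ inner ℝ (Q' x) x)
    (hY : Q * Q - Q' * Q' = Y) (hd : ‖Y‖ ≤ d) : ‖Q - Q'‖ ≤ d / s := by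
  obtain ⟨hQs, hQp⟩ := (nonneg_iff' Q).1 hQ
  obtain ⟨hQs', hQp'⟩ := (nonneg_iff' Q').1 hQ'
  set X := Q - Q' with hX
  have hXs : SymOp X := fun x y => by
    simp [hX, inner_sub_left, inner_sub_right, hQs x y, hQs' x y]
  have hd0 : 0 ≤ d := (norm_nonneg _).trans hd
  rw [le_div_iff₀ hs]
  set c := ‖X‖ with hc
  rcases eq_or_lt_of_le (norm_nonneg X) with h0 | h0
  · rw [hc, ← h0]; simpa using hd0
  -- the key identity
  have key : ∀ x, inner ℝ (X x) ((Q + Q') x) = inner ℝ (Y x) x := by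
    intro x
    have e1 : inner ℝ (Y x) x = inner ℝ (Q x) (Q x) - inner ℝ (Q' x) (Q' x) := by
      rw [← hY, ← hQs (Q x) x, ← hQs' (Q' x) x]
      simp [inner_sub_left]
    rw [e1]
    simp only [hX, sub_apply, add_apply, inner_sub_left,
      inner_add_right]
    rw [real_inner_comm (Q x) (Q' x)]
    ring
  have main : ∀ m, 0 ≤ m → m < c → m * s ≤ d + Real.sqrt (c ^ 2 - m ^ 2) * ‖Q + Q'‖ := by
    intro m hm0 hmc
    have h1 : ¬ ∀ x, |inner ℝ (X x) x| ≤ m * ‖x‖ ^ 2 := fun h =>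
      absurd (sym_norm_le hXs hm0 h) (not_le.2 hmc)
    push Not at h1
    obtain ⟨y, hy⟩ := h1
    have hy0 : 0 < ‖y‖ := by
      rw [norm_pos_iff]; rintro rfl; simp at hy
    -- normalise
    set x := ‖y‖⁻¹ • y with hx
    have hx1 : ‖x‖ = 1 := by rw [hx, norm_smul]; simp [hy0.ne']
    set l := inner ℝ (X x) x with hl
    have hlm : m < |l| := by
      have : l = (‖y‖ ^ 2)⁻¹ * inner ℝ (X y) y := by
        simp only [hl, hx, map_smul, inner_smul_left, inner_smul_right, conj_trivial]
        field_simp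
      rw [this, abs_mul, abs_of_nonneg (by positivity), inv_mul_eq_div, lt_div_iff₀ (by positivity)]
      exact hy
    have hXx : ‖X x‖ ≤ c := by simpa [hx1] using X.le_opNorm x
    have h2 : ‖X x - l • x‖ ≤ Real.sqrt (c ^ 2 - m ^ 2) := by
      apply Real.le_sqrt_of_sq_le
      rw [norm_sub_sq_real, inner_smul_right, ← hl, norm_smul, hx1, mul_one, Real.norm_eq_abs,
        sq_abs]
      have : m ^ 2 ≤ l ^ 2 := by rw [← sq_abs l]; gcongr
      have : ‖X x‖ ^ 2 ≤ c ^ 2 := by gcongr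
      nlinarith
    have h3 : inner ℝ (X x) ((Q + Q') x) = l * inner ℝ x ((Q + Q') x) +
        inner ℝ (X x - l • x) ((Q + Q') x) := by
      simp [inner_sub_left, inner_smul_left]
    rw [key] at h3
    have h4 : |inner ℝ (Y x) x| ≤ d := by
      calc _ ≤ ‖Y x‖ * ‖x‖ := abs_real_inner_le_norm _ _
        _ ≤ d * ‖x‖ * ‖x‖ := by gcongr; exact Y.le_of_opNorm_le hd x
        _ = d := by simp [hx1]
    have h5 : |inner ℝ (X x - l • x) ((Q + Q') x)| ≤ Real.sqrt (c ^ 2 - m ^ 2) * ‖Q + Q'‖ := by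
      calc _ ≤ ‖X x - l • x‖ * ‖(Q + Q') x‖ := abs_real_inner_le_norm _ _
        _ ≤ _ := by
          gcongr
          simpa [hx1] using (Q + Q').le_opNorm x
    have h6 : s ≤ inner ℝ x ((Q + Q') x) := by
      have a1 := hb x
      have a2 := hQp x
      rw [hx1] at a1
      rw [add_apply, inner_add_right, ← hQs, ← hQs']
      linarith
    have h7 : |l| * inner ℝ x ((Q + Q') x) ≤ d + Real.sqrt (c ^ 2 - m ^ 2) * ‖Q + Q'‖ := by
      have e1 : l * inner ℝ x ((Q + Q') x) =
        inner ℝ (Y x) x - inner ℝ (X x - l • x) ((Q + Q') x) := by linarith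
      rw [← abs_of_nonneg (hs.le.trans h6), ← abs_mul, e1]
      exact (abs_sub _ _).trans (add_le_add h4 h5)
    exact le_trans (mul_le_mul hlm.le h6 hs.le (abs_nonneg _)) h7
  have hcont : Continuous fun m : ℝ => d + Real.sqrt (c ^ 2 - m ^ 2) * ‖Q + Q'‖ - m * s := by
    fun_prop
  have ht := (hcont.tendsto c).mono_left (nhdsWithin_le_nhds (s := Set.Iio c))
  have hev : ∀ᶠ m in nhdsWithin c (Set.Iio c),
      0 ≤ d + Real.sqrt (c ^ 2 - m ^ 2) * ‖Q + Q'‖ - m * s := by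
    filter_upwards [Ioo_mem_nhdsLT h0] with m hm
    linarith [main m hm.1.le hm.2]
  have := ge_of_tendsto ht hev
  simp at this
  linarith

lemma midpoint_bound {g : ℝ → ℝ}
    (hg : ∀ s t, 0 ≤ s → s < t → t ≤ 1 → g ((s + t) / 2) ≤ (g s + g t) / 2)
    (hc : ContinuousOn g (Set.Icc (1 / 2) 1)) {r : ℝ} (hr0 : 0 ≤ r) (hr1 : r ≤ 1) :
    g r ≤ (1 - r) * g 0 + r * g 1 := by
  set f : ℝ → ℝ := fun r => g r - ((1 - r) * g 0 + r * g 1) with hf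
  have f0 : f 0 = 0 := by simp [hf]
  have f1 : f 1 = 0 := by simp [hf]
  have hmid : ∀ s t, 0 ≤ s → s < t → t ≤ 1 → f ((s + t) / 2) ≤ (f s + f t) / 2 := by
    intro s t h1 h2 h3
    have := hg s t h1 h2 h3
    simp only [hf]
    linarith
  have hfc : ContinuousOn f (Set.Icc (1 / 2) 1) := hc.sub (by fun_prop)
  obtain ⟨M, hM⟩ := (isCompact_Icc.image_of_continuousOn hfc).bddAbove
  have hM' : ∀ r, 1 / 2 ≤ r → r ≤ 1 → f r ≤ M := fun r h1 h2 => hM ⟨r, ⟨h1, h2⟩, rfl⟩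
  have hM0 : 0 ≤ M := by rw [← f1]; exact hM' 1 (by norm_num) le_rfl
  have low : ∀ r, 0 < r → r ≤ 1 / 2 → f r ≤ f (2 * r) / 2 := fun r h1 h2 => by
    have := hmid 0 (2 * r) le_rfl (by linarith) (by linarith)
    rw [f0, show (0 + 2 * r) / 2 = r by ring] at this
    linarith
  have high : ∀ r, 1 / 2 ≤ r → r < 1 → f r ≤ f (2 * r - 1) / 2 := fun r h1 h2 => by
    have := hmid (2 * r - 1) 1 (by linarith) (by linarith) (by linarith)
    rw [f1, show (2 * r - 1 + 1) / 2 = r by ring] at this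
    linarith
  have c1 : ∀ n : ℕ, ∀ r, (1 / 2 : ℝ) ^ (n + 1) ≤ r → r ≤ 1 → f r ≤ M := by
    intro n
    induction n with
    | zero => intro r h1 h2; exact hM' r (by simpa using h1) h2
    | succ n ih =>
      intro r h1 h2
      rcases le_total (1 / 2) r with h | h
      · exact hM' r h h2
      · have hp : 0 < r := lt_of_lt_of_le (by positivity) h1
        have a := low r hp h
        have b := ih (2 * r) (by rw [pow_succ] at h1; linarith) (by linarith)
        linarith
  have c2 : ∀ r, 0 ≤ r → r ≤ 1 → f r ≤ M := by
    intro r h1 h2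
    rcases eq_or_lt_of_le h1 with h | h
    · rw [← h, f0]; exact hM0
    · obtain ⟨n, hn⟩ := exists_pow_lt_of_lt_one h (by norm_num : (1 / 2 : ℝ) < 1)
      refine c1 n r (le_trans ?_ hn.le) h2
      rw [pow_succ]
      have : 0 < (1 / 2 : ℝ) ^ n := by positivity
      linarith
  have c3 : ∀ n : ℕ, ∀ r, 0 ≤ r → r ≤ 1 → f r ≤ M * (1 / 2) ^ n := by
    intro n
    induction n with
    | zero => intro r h1 h2; simpa using c2 r h1 h2
    | succ n ih =>
      intro r h1 h2
      have hpos : 0 ≤ M * (1 / 2) ^ (n + 1) := by positivity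
      rcases eq_or_lt_of_le h1 with h | h
      · rw [← h, f0]; exact hpos
      rcases eq_or_lt_of_le h2 with h' | h'
      · rw [h', f1]; exact hpos
      rw [pow_succ]
      rcases le_total (1 / 2) r with h3 | h3
      · have a := high r h3 h'
        have b := ih (2 * r - 1) (by linarith) (by linarith)
        linarith
      · have a := low r h h3
        have b := ih (2 * r) (by linarith) (by linarith)
        linarith
  have ht : Filter.Tendsto (fun n : ℕ => M * (1 / 2 : ℝ) ^ n) Filter.atTop (nhds (M * 0)) :=
    (tendsto_pow_atTop_nhds_zero_of_lt_one (by norm_num) (by norm_num)).const_mul M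
  have := ge_of_tendsto' ht (fun n => c3 n r hr0 hr1)
  simp only [hf, mul_zero] at this
  linarith

lemma pow_bound_one {P : ℝ → E →L[ℝ] E}
    (hpos : ∀ r, 0 < r → 0 ≤ P r)
    (hadd : ∀ s t, 0 < s → 0 < t → P (s + t) = P s * P t)
    (hcont : ∀ x : E, ContinuousOn (fun r : ℝ => P r x) (Set.Ioi (0 : ℝ)))
    {b : ℝ} (hb0 : 0 < b) (hb1 : b ≤ 1) (x : E) :
    inner ℝ (P b x) x ≤ (1 - b) * ‖x‖ ^ 2 + b * inner ℝ (P 1 x) x := by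
  set g : ℝ → ℝ := fun r => if r = 0 then ‖x‖ ^ 2 else inner ℝ (P r x) x with hg
  have hprod : ∀ s t, 0 < s → 0 < t → inner ℝ (P s x) (P t x) = inner ℝ (P (s + t) x) x := by
    intro s t hs ht
    rw [add_comm, hadd t s ht hs, ← ((nonneg_iff' _).1 (hpos t ht)).1 (P s x) x]
    rfl
  have h := midpoint_bound (g := g) ?_ ?_ hb0.le hb1
  · simpa [hg, hb0.ne'] using h
  · intro s t hs hst ht
    have htp : 0 < t := lt_of_le_of_lt hs hst
    rcases eq_or_lt_of_le hs with h0 | h0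
    · subst h0
      have h1 : 0 ≤ ‖x - P (t / 2) x‖ ^ 2 := by positivity
      rw [norm_sub_sq_real, real_inner_comm, ← real_inner_self_eq_norm_sq (P (t / 2) x),
        hprod _ _ (half_pos htp) (half_pos htp), add_halves] at h1
      simp only [hg, if_true, htp.ne', if_false, zero_add, (half_pos htp).ne']
      linarith
    · have h1 : 0 ≤ ‖P (s / 2) x - P (t / 2) x‖ ^ 2 := by positivity
      rw [norm_sub_sq_real, ← real_inner_self_eq_norm_sq (P (t / 2) x),
        ← real_inner_self_eq_norm_sq (P (s / 2) x),
        hprod _ _ (half_pos htp) (half_pos htp), hprod _ _ (half_pos h0) (half_pos h0),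
        hprod _ _ (half_pos h0) (half_pos htp), add_halves, add_halves, ← add_div] at h1
      have : (s + t) / 2 ≠ 0 := by positivity
      simp only [hg, htp.ne', if_false, h0.ne', this]
      linarith
  · have h1 : ContinuousOn (fun r : ℝ => inner ℝ (P r x) x) (Set.Icc (1 / 2) 1) := by
      refine ContinuousOn.inner (𝕜 := ℝ) ((hcont x).mono ?_) continuousOn_const
      intro r hr
      exact lt_of_lt_of_le (by norm_num) hr.1
    refine h1.congr fun r hr => ?_
    have : r ≠ 0 := (lt_of_lt_of_le (by norm_num) hr.1).ne'
    simp [hg, this]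

lemma pow_bound {P : ℝ → E →L[ℝ] E}
    (hpos : ∀ r, 0 < r → 0 ≤ P r)
    (hadd : ∀ s t, 0 < s → 0 < t → P (s + t) = P s * P t)
    (hcont : ∀ x : E, ContinuousOn (fun r : ℝ => P r x) (Set.Ioi (0 : ℝ)))
    {b c : ℝ} (hc : 0 < c) (hb0 : 0 < b) (hb1 : b ≤ 1) (x : E) :
    inner ℝ (P b x) x ≤ c ^ b * ((1 - b) * ‖x‖ ^ 2 + b * (c⁻¹ * inner ℝ (P 1 x) x)) := by
  have h := pow_bound_one (P := fun r => (c ^ (-r)) • P r) ?_ ?_ ?_ hb0 hb1 x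
  · simp only [smul_apply, inner_smul_left, conj_trivial, Real.rpow_neg_one,
      Real.rpow_neg hc.le b] at h
    rwa [inv_mul_le_iff₀ (by positivity)] at h
  · intro r hr
    obtain ⟨h1, h2⟩ := (nonneg_iff' _).1 (hpos r hr)
    rw [nonneg_iff']
    refine ⟨fun x y => ?_, fun x => ?_⟩
    · simp [inner_smul_left, inner_smul_right, h1 x y]
    · simp only [smul_apply, inner_smul_left, conj_trivial]
      exact mul_nonneg (by positivity) (h2 x)
  · intro s t hs ht
    simp only [smul_mul_smul_comm, hadd s t hs ht, neg_add, Real.rpow_add hc]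
  · intro x
    refine ContinuousOn.smul (Continuous.continuousOn ?_) (hcont x)
    exact Real.continuous_const_rpow hc.ne' |>.comp continuous_neg

lemma pow_norm_le_one {P : ℝ → E →L[ℝ] E}
    (hpos : ∀ r, 0 < r → 0 ≤ P r)
    (hadd : ∀ s t, 0 < s → 0 < t → P (s + t) = P s * P t)
    (hcont : ∀ x : E, ContinuousOn (fun r : ℝ => P r x) (Set.Ioi (0 : ℝ)))
    {b : ℝ} (hb0 : 0 < b) (hb1 : b ≤ 1) : ‖P b‖ ≤ ‖P 1‖ ^ b := by
  have main : ∀ c, ‖P 1‖ < c → ‖P b‖ ≤ c ^ b := by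
    intro c hc
    have hc0 : 0 < c := lt_of_le_of_lt (norm_nonneg _) hc
    obtain ⟨h1, h2⟩ := (nonneg_iff' _).1 (hpos b hb0)
    refine sym_norm_le h1 (by positivity) fun x => ?_
    rw [abs_of_nonneg (h2 x)]
    refine (pow_bound hpos hadd hcont hc0 hb0 hb1 x).trans ?_
    gcongr
    have h3 : inner ℝ (P 1 x) x ≤ c * ‖x‖ ^ 2 := by
      calc _ ≤ ‖P 1 x‖ * ‖x‖ := real_inner_le_norm _ _
        _ ≤ c * ‖x‖ * ‖x‖ := by gcongr; exact (P 1).le_of_opNorm_le hc.le x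
        _ = _ := by ring
    have h4 : c⁻¹ * inner ℝ (P 1 x) x ≤ ‖x‖ ^ 2 := by
      rw [inv_mul_le_iff₀ hc0]; exact h3
    nlinarith
  have hcont2 : Continuous fun c : ℝ => c ^ b := Real.continuous_rpow_const hb0.le
  have ht := (hcont2.tendsto ‖P 1‖).mono_left (nhdsWithin_le_nhds (s := Set.Ioi ‖P 1‖))
  refine ge_of_tendsto ht ?_
  filter_upwards [self_mem_nhdsWithin] with c hc using main c hc

lemma pow_norm_le {P : ℝ → E →L[ℝ] E}
    (hpos : ∀ r, 0 < r → 0 ≤ P r)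
    (hadd : ∀ s t, 0 < s → 0 < t → P (s + t) = P s * P t)
    (hcont : ∀ x : E, ContinuousOn (fun r : ℝ => P r x) (Set.Ioi (0 : ℝ)))
    {b : ℝ} (hb0 : 0 < b) : ‖P b‖ ≤ ‖P 1‖ ^ b := by
  have main : ∀ n : ℕ, ∀ b : ℝ, 0 < b → b ≤ n + 1 → ‖P b‖ ≤ ‖P 1‖ ^ b := by
    intro n
    induction n with
    | zero => intro b h1 h2; exact pow_norm_le_one hpos hadd hcont h1 (by simpa using h2)
    | succ n ih =>
      intro b h1 h2
      rcases le_or_gt b 1 with h | h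
      · exact pow_norm_le_one hpos hadd hcont h1 h
      · have a := ih (b - 1) (by linarith) (by push_cast at h2; linarith)
        have e1 : P b = P (b - 1) * P 1 := by
          rw [← hadd (b - 1) 1 (by linarith) one_pos, sub_add_cancel]
        have e2 : ‖P 1‖ ^ b = ‖P 1‖ ^ (b - 1) * ‖P 1‖ := by
          conv_lhs => rw [← sub_add_cancel b 1]
          rw [Real.rpow_add_of_nonneg (norm_nonneg _) (by linarith) zero_le_one, Real.rpow_one]
        rw [e1, e2]
        exact (norm_mul_le _ _).trans (by gcongr)
  obtain ⟨n, hn⟩ := exists_nat_ge b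
  exact main n b hb0 (by linarith)

lemma shrink_bound {P : ℝ → E →L[ℝ] E}
    (hpos : ∀ r, 0 < r → 0 ≤ P r)
    (hadd : ∀ s t, 0 < s → 0 < t → P (s + t) = P s * P t)
    (hcont : ∀ x : E, ContinuousOn (fun r : ℝ => P r x) (Set.Ioi (0 : ℝ)))
    {ε : ℝ} (hε : 0 < ε) {Q G : E →L[ℝ] E} (hQ0 : 0 ≤ Q)
    (hQ : Q * Q = ε • (1 : E →L[ℝ] E) + P 1) (hQG : Q * G = 1) (hGQ : G * Q = 1)
    (hGs : SymOp G)
    (hcQ : ∀ r, 0 < r → P r * Q = Q * P r) (hcG : ∀ r, 0 < r → P r * G = G * P r)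
    {b : ℝ} (hb0 : 0 < b) (hb1 : b ≤ 1) :
    ‖(P (1 / 2) * G - 1) * P b‖ ≤ ε ^ b := by
  obtain ⟨hQs, hQp⟩ := (nonneg_iff' Q).1 hQ0
  obtain ⟨hbs, hbp⟩ := (nonneg_iff' _).1 (hpos b hb0)
  obtain ⟨h1s, h1p⟩ := (nonneg_iff' _).1 (hpos 1 one_pos)
  obtain ⟨hhs, hhp⟩ := (nonneg_iff' _).1 (hpos (1 / 2) (by norm_num))
  obtain ⟨hqs, hqp⟩ := (nonneg_iff' _).1 (hpos (1 / 4) (by norm_num))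
  have hQGx : ∀ x, Q (G x) = x := fun x => by
    simpa using congrArg (fun T : E →L[ℝ] E => T x) hQG
  set W := G * P b * G with hW
  have hWin : ∀ x, inner ℝ (W x) x = inner ℝ (P b (G x)) (G x) := fun x => hGs _ _
  have hWs : SymOp W := fun x y => by
    change inner ℝ (G (P b (G x))) y = inner ℝ x (G (P b (G y)))
    rw [hGs, hbs, hGs]
  have hWn : ‖W‖ ≤ ε ^ b * ε⁻¹ := by
    refine sym_norm_le hWs (by positivity) fun x => ?_
    rw [hWin, abs_of_nonneg (hbp _), mul_assoc]
    refine (pow_bound hpos hadd hcont hε hb0 hb1 (G x)).trans ?_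
    gcongr
    have h1 := norm_sq_root hQs hQ (G x)
    rw [hQGx] at h1
    have h2 : ε⁻¹ * ‖x‖ ^ 2 = ‖G x‖ ^ 2 + ε⁻¹ * inner ℝ (P 1 (G x)) (G x) := by
      rw [h1]; field_simp
    have h3 : 0 ≤ ε⁻¹ * inner ℝ (P 1 (G x)) (G x) := mul_nonneg (by positivity) (h1p _)
    rw [h2]
    nlinarith [sq_nonneg ‖G x‖]
  have hPP : P (1 / 2) * P (1 / 2) = P 1 := by
    rw [← hadd _ _ (by norm_num) (by norm_num)]; norm_num
  have hqq : P (1 / 4) * P (1 / 4) = P (1 / 2) := by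
    rw [← hadd _ _ (by norm_num) (by norm_num)]; norm_num
  -- `‖Q y‖ ≤ ‖(Q + P) y‖`
  have hQP : ∀ y, ‖Q y‖ ≤ ‖(Q + P (1 / 2)) y‖ := by
    intro y
    refine le_of_sq_le_sq ?_ (norm_nonneg _)
    rw [add_apply, norm_add_sq_real]
    have h1 : inner ℝ (Q y) (P (1 / 2) y) = inner ℝ (Q (P (1 / 4) y)) (P (1 / 4) y) := by
      have e1 : P (1 / 4) (Q y) = Q (P (1 / 4) y) := by
        simpa using congrArg (fun T : E →L[ℝ] E => T y) (hcQ (1 / 4) (by norm_num))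
      rw [← e1, hqs, ← hqq]
      rfl
    rw [h1]
    have := hQp (P (1 / 4) y)
    have := sq_nonneg ‖P (1 / 2) y‖
    linarith
  have hid : (Q + P (1 / 2)) * (P (1 / 2) * G - 1) * (G * P b) = (-ε) • W := by
    have e1 : (Q + P (1 / 2)) * (P (1 / 2) * G - 1) = (-ε) • G := by
      have a1 : Q * (P (1 / 2) * G) = P (1 / 2) := by
        rw [← mul_assoc, ← hcQ _ (by norm_num), mul_assoc, hQG, mul_one]
      have a2 : P 1 = Q * Q - ε • (1 : E →L[ℝ] E) := by rw [hQ]; abel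
      have a3 : P (1 / 2) * (P (1 / 2) * G) = Q - ε • G := by
        rw [← mul_assoc, hPP, a2, sub_mul, mul_assoc, hQG, mul_one, smul_mul_assoc, one_mul]
      rw [mul_sub, add_mul, a1, a3, mul_one, neg_smul]
      abel
    rw [e1, hW, smul_mul_assoc, ← hcG b hb0, ← mul_assoc, ← hcG b hb0]
  have hmove : (P (1 / 2) * G - 1) * P b = Q * ((P (1 / 2) * G - 1) * (G * P b)) := by
    have e1 : Q * (P (1 / 2) * G - 1) = (P (1 / 2) * G - 1) * Q := by
      rw [mul_sub, sub_mul, ← mul_assoc, ← hcQ _ (by norm_num), mul_assoc, mul_assoc, hQG, hGQ,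
        mul_one, one_mul, mul_one]
    rw [← mul_assoc, e1, mul_assoc, ← mul_assoc Q, hQG, one_mul]
  refine ContinuousLinearMap.opNorm_le_bound _ (by positivity) fun x => ?_
  rw [hmove]
  refine (hQP (((P (1 / 2) * G - 1) * (G * P b)) x)).trans ?_
  have e2 : (Q + P (1 / 2)) (((P (1 / 2) * G - 1) * (G * P b)) x) = (-ε) • W x := by
    have := congrArg (fun T : E →L[ℝ] E => T x) hid
    rw [mul_assoc] at this
    exact this
  rw [e2, norm_smul, norm_neg, Real.norm_eq_abs, abs_of_pos hε]
  calc ε * ‖W x‖ ≤ ε * (ε ^ b * ε⁻¹ * ‖x‖) := by gcongr; exact W.le_of_opNorm_le hWn x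
    _ = _ := by field_simp

end Helpers

/-- Deterministic error bound for estimating the correlation operator `R₀ = D^β Φ D^β`
(with `C₀ = D^{1/2} R₀ D^{1/2}`) from an estimate `Ĉ₀` of `C₀` and `D̂` of `D`, both
accurate to within `δ` in Hilbert–Schmidt norm, using the regularized estimator
`R̂₀ := (εI + D̂)^{−1/2} Ĉ₀ (εI + D̂)^{−1/2}`:  with `b := min(β, 1)`,
`‖R̂₀ − R₀‖₂ ≤ 2 (1 + ‖R₀‖₂)(δ²/ε² + δ/ε) + 2 ε^b ‖Φ‖₂ ‖D‖^{2β − b}`.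
The powers `D^r` (for `r > 0`) are given by the continuous functional calculus,
characterized here by the defining properties of the positive power semigroup `Dpow`;
`(εI + D̂)^{−1/2}` is the ring inverse of the unique positive square root `Qhat` of
`εI + D̂`.  Hilbert–Schmidt norms are computed through a Hilbert basis `(eᵢ)`; `‖D‖` is
the operator norm. -/
theorem stmt_11 {E : Type*} [NormedAddCommGroup E] [InnerProductSpace ℝ E] [CompleteSpace E]
    {ι : Type*} (e : HilbertBasis ι ℝ E)
    (ε δ β : ℝ) (hε : 0 < ε) (hδ : 0 ≤ δ) (hβ : 0 < β)
    (D Dhat : E →L[ℝ] E) (hD : 0 ≤ D) (hDhat : 0 ≤ Dhat)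
    (hDD_HS : Summable fun i => ‖(Dhat - D) (e i)‖ ^ 2)
    (hDD : Real.sqrt (∑' i, ‖(Dhat - D) (e i)‖ ^ 2) ≤ δ)
    (Φ : E →L[ℝ] E) (hΦ_HS : Summable fun i => ‖Φ (e i)‖ ^ 2)
    -- the power semigroup `r ↦ D^r` for `r > 0`, i.e. the continuous functional calculus
    (Dpow : ℝ → E →L[ℝ] E)
    (hDpow_pos : ∀ r, 0 < r → 0 ≤ Dpow r)
    (hDpow_add : ∀ s t, 0 < s → 0 < t → Dpow (s + t) = Dpow s * Dpow t)
    (hDpow_one : Dpow 1 = D)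
    (hDpow_cont : ∀ x : E, ContinuousOn (fun r : ℝ => Dpow r x) (Set.Ioi (0 : ℝ)))
    -- `(εI + D̂)^{1/2}`: the unique positive square root of `εI + D̂`
    (Qhat : E →L[ℝ] E) (hQhat_pos : 0 ≤ Qhat)
    (hQhat : Qhat * Qhat = ε • (1 : E →L[ℝ] E) + Dhat)
    -- the estimate `Ĉ₀` of `C₀ = D^{1/2} R₀ D^{1/2}`, `R₀ = D^β Φ D^β`
    (Chat₀ : E →L[ℝ] E)
    (hChat₀_HS : Summable fun i =>
      ‖(Chat₀ - Dpow (1 / 2) * (Dpow β * Φ * Dpow β) * Dpow (1 / 2)) (e i)‖ ^ 2)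
    (hCC : Real.sqrt (∑' i,
      ‖(Chat₀ - Dpow (1 / 2) * (Dpow β * Φ * Dpow β) * Dpow (1 / 2)) (e i)‖ ^ 2) ≤ δ) :
    Real.sqrt (∑' i,
        ‖(Ring.inverse Qhat * Chat₀ * Ring.inverse Qhat -
            Dpow β * Φ * Dpow β) (e i)‖ ^ 2) ≤
      2 * (1 + Real.sqrt (∑' i, ‖(Dpow β * Φ * Dpow β) (e i)‖ ^ 2)) *
          (δ ^ 2 / ε ^ 2 + δ / ε) +
        2 * ε ^ min β 1 * Real.sqrt (∑' i, ‖Φ (e i)‖ ^ 2) * ‖D‖ ^ (2 * β - min β 1) := by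
  obtain ⟨Q, hQ0, hQ, hQc⟩ := exists_sqrt_aux hε hD
  obtain ⟨hQG, hGQ, hGs, hGn, hQb⟩ := root_facts hε hD hQ0 hQ
  obtain ⟨hQA, hAQ, hAs, hAn, hQhb⟩ := root_facts hε hDhat hQhat_pos hQhat
  set G := Ring.inverse Q with hG
  set A := Ring.inverse Qhat with hA
  have hcD : ∀ r, 0 < r → Commute (Dpow r) D := fun r hr => by
    change _ * _ = _ * _
    rw [← hDpow_one, ← hDpow_add r 1 hr one_pos, ← hDpow_add 1 r one_pos hr, add_comm]
  have hcQ : ∀ r, 0 < r → Dpow r * Q = Q * Dpow r := fun r hr => hQc _ (hcD r hr)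
  have hcG : ∀ r, 0 < r → Dpow r * G = G * Dpow r := fun r hr => by
    calc Dpow r * G = G * Q * Dpow r * G := by rw [hGQ, one_mul]
      _ = G * (Q * Dpow r) * G := by rw [mul_assoc G Q]
      _ = G * Dpow r * (Q * G) := by rw [← hcQ r hr]; simp only [mul_assoc]
      _ = _ := by rw [hQG, mul_one]
  have hQ' : Q * Q = ε • (1 : E →L[ℝ] E) + Dpow 1 := by rw [hDpow_one, hQ]
  have hs0 : 0 < Real.sqrt ε := Real.sqrt_pos.2 hε
  set P := Dpow (1 / 2) with hP
  set B := Dpow β with hB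
  set S := P * G with hS
  set φ := Real.sqrt (∑' i, ‖Φ (e i)‖ ^ 2) with hφ
  have hφ0 : 0 ≤ φ := Real.sqrt_nonneg _
  have hΦ : HSle e Φ φ := ⟨hΦ_HS, le_rfl⟩
  have hb0 : 0 < min β 1 := lt_min hβ one_pos
  have hBn : ‖B‖ ≤ ‖D‖ ^ β := by
    have := pow_norm_le hDpow_pos hDpow_add hDpow_cont hβ
    rwa [hDpow_one] at this
  -- the shrinkage bound
  set κ := ε ^ min β 1 * ‖D‖ ^ (β - min β 1) with hκ
  have hκ0 : 0 ≤ κ := by positivity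
  have hshr : ‖(S - 1) * B‖ ≤ κ := by
    have h1 := shrink_bound hDpow_pos hDpow_add hDpow_cont hε hQ0 hQ' hQG hGQ hGs hcQ hcG hb0
      (min_le_right β 1)
    rcases le_or_gt β 1 with h | h
    · rw [min_eq_left h] at h1
      rw [hκ, min_eq_left h, sub_self, Real.rpow_zero, mul_one]
      exact h1
    · rw [min_eq_right h.le] at h1
      rw [hκ, min_eq_right h.le]
      have e1 : B = Dpow 1 * Dpow (β - 1) := by
        rw [← hDpow_add 1 (β - 1) one_pos (by linarith), hB]; congr 1; ring
      have h2 := pow_norm_le hDpow_pos hDpow_add hDpow_cont (b := β - 1) (by linarith)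
      rw [hDpow_one] at h2
      rw [e1, ← mul_assoc]
      exact (norm_mul_le _ _).trans (by gcongr)
  have hshr2 : ‖B * (S - 1)‖ ≤ κ := by
    have e1 : B * (S - 1) = (S - 1) * B := by
      have a1 : B * P = P * B := by
        rw [hB, hP, ← hDpow_add _ _ hβ (by norm_num), ← hDpow_add _ _ (by norm_num) hβ, add_comm]
      rw [hS, mul_sub, sub_mul, ← mul_assoc, a1, mul_assoc, hcG β hβ, mul_assoc, one_mul, mul_one]
    rw [e1]; exact hshr
  -- `‖S‖ ≤ 1`
  have hSn : ‖S‖ ≤ 1 := by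
    refine S.opNorm_le_bound zero_le_one fun x => ?_
    obtain ⟨hPs, -⟩ := (nonneg_iff' P).1 (hDpow_pos _ (by norm_num))
    obtain ⟨hQs, -⟩ := (nonneg_iff' Q).1 hQ0
    have hPP : P * P = (0 : ℝ) • (1 : E →L[ℝ] E) + D := by
      rw [hP, ← hDpow_add _ _ (by norm_num) (by norm_num), zero_smul, zero_add, ← hDpow_one]
      norm_num
    have h1 := norm_sq_root hPs hPP (G x)
    have h2 := norm_sq_root hQs hQ (G x)
    have h3 : Q (G x) = x := by
      simpa using congrArg (fun T : E →L[ℝ] E => T x) hQG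
    rw [h3] at h2
    change ‖P (G x)‖ ≤ _
    rw [one_mul]
    refine le_of_sq_le_sq ?_ (norm_nonneg _)
    rw [h1, h2]
    have : 0 ≤ ε * ‖G x‖ ^ 2 := by positivity
    linarith
  -- perturbation of the root
  have hX : ‖Q - Qhat‖ ≤ δ / Real.sqrt ε := by
    have h1 : HSle e (Dhat - D) δ := ⟨hDD_HS, hDD⟩
    refine sylvester hs0 hQ0 hQhat_pos hQhb rfl ?_
    rw [hQ, hQhat, add_sub_add_left_eq_sub, norm_sub_rev]
    exact h1.norm_le
  set η := δ / ε with hη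
  have hη0 : 0 ≤ η := by positivity
  have hηe : (Real.sqrt ε)⁻¹ * (δ / Real.sqrt ε) = η := by
    rw [hη, inv_mul_eq_div, div_div, Real.mul_self_sqrt hε.le]
  have hT1 : ‖A * P - S‖ ≤ η := by
    have e1 : A * P - S = A * (Q - Qhat) * S := by
      have a1 : Q * S = P := by
        rw [hS, ← mul_assoc, ← hcQ _ (by norm_num), mul_assoc, hQG, mul_one]
      rw [mul_sub, hAQ, sub_mul, mul_assoc, a1, one_mul]
    rw [e1, ← hηe]
    calc _ ≤ ‖A‖ * ‖Q - Qhat‖ * ‖S‖ :=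
          (norm_mul_le _ _).trans (by gcongr; exact norm_mul_le _ _)
      _ ≤ (Real.sqrt ε)⁻¹ * (δ / Real.sqrt ε) * 1 := by gcongr
      _ = _ := mul_one _
  have hT2 : ‖P * A - S‖ ≤ η := by
    have e1 : P * A - S = S * ((Q - Qhat) * A) := by
      have a1 : S * Q = P := by
        rw [hS, mul_assoc, hGQ, mul_one]
      rw [sub_mul, hQA, mul_sub, ← mul_assoc, a1, mul_one]
    rw [e1, ← hηe]
    calc _ ≤ ‖S‖ * (‖Q - Qhat‖ * ‖A‖) :=
          (norm_mul_le _ _).trans (by gcongr; exact norm_mul_le _ _)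
      _ ≤ 1 * ((δ / Real.sqrt ε) * (Real.sqrt ε)⁻¹) := by gcongr
      _ = _ := by ring
  set R := B * Φ * B with hR
  set ρ := Real.sqrt (∑' i, ‖R (e i)‖ ^ 2) with hρ
  have hρ0 : 0 ≤ ρ := Real.sqrt_nonneg _
  have hRH : HSle e R ρ := ⟨((hΦ.mul_left hBn).mul_right hBn).1, le_rfl⟩
  have hC : HSle e (Chat₀ - P * R * P) δ := ⟨hChat₀_HS, hCC⟩
  have t1 := (hC.mul_left hAn).mul_right hAn
  have t2 := (hRH.mul_left hT1).mul_right hT2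
  have t3 := (hRH.mul_left hT1).mul_right hSn
  have t4 := (hRH.mul_left hSn).mul_right hT2
  have t5 := ((hΦ.mul_left hBn).mul_right hshr2).mul_left hSn
  have t6 := (hΦ.mul_left hshr).mul_right hBn
  have t := t1.add (((t2.add t3).add t4).add (t5.add t6))
  have hdec : A * (Chat₀ - P * R * P) * A + ((((A * P - S) * R * (P * A - S) +
      (A * P - S) * R * S) + S * R * (P * A - S)) +
      (S * (B * Φ * (B * (S - 1))) + (S - 1) * B * Φ * B)) = A * Chat₀ * A - R := by
    have e1 : S * (B * Φ * (B * (S - 1))) = S * R * S - S * R := by rw [hR]; noncomm_ring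
    have e2 : (S - 1) * B * Φ * B = S * R - R := by rw [hR]; noncomm_ring
    rw [e1, e2]
    noncomm_ring
  rw [hdec] at t
  refine t.2.trans ?_
  have hc1 : (Real.sqrt ε)⁻¹ * δ * (Real.sqrt ε)⁻¹ = η := by rw [← hηe]; ring
  have hc2 : δ ^ 2 / ε ^ 2 = η ^ 2 := by rw [hη, div_pow]
  have hc3 : ‖D‖ ^ (2 * β - min β 1) = ‖D‖ ^ β * ‖D‖ ^ (β - min β 1) := by
    rw [← Real.rpow_add_of_nonneg (norm_nonneg _) hβ.le (sub_nonneg.2 (min_le_left _ _))]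
    congr 1; ring
  rw [hc1, hc2, hc3]
  have hfin : 2 * ε ^ min β 1 * φ * (‖D‖ ^ β * ‖D‖ ^ (β - min β 1)) = 2 * (κ * φ * ‖D‖ ^ β) := by
    rw [hκ]; ring
  rw [hfin]
  have := mul_nonneg hη0 hρ0
  have := mul_nonneg (sq_nonneg η) hρ0
  nlinarith [sq_nonneg η]
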